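/- Let N ≥ 3, p > 1 and σ ∈ (0,1). Let h : (0,∞) → ℝ be continuous with 0 ≤ h(s) and s·h(s) ≤ σ for all s > 0. Let α > 0 and define ψ : [0,∞) → [0,∞) by ψ(s) = ∫₀^s exp(−∫_α^t h(r) dr) dt. Assume that the function s ↦ ψ'(s)·s^p / ψ(s)^{2*−1} is strictly decreasing on (0,∞), where 2* = 2N/(N−2). Let ℝ^N₊ = {x ∈ ℝ^N : x_N > 0} be the open upper half-space. Then there is no function u : ℝ^N → ℝ that is continuous on the closed half-space {x_N ≥ 0}, vanishes on the hyperplane {x_N = 0}, is twice continuously differentiable and positive on ℝ^N₊, and satisfies −Δu(x) + h(u(x))·‖∇u(x)‖² = u(x)^p for every x ∈ ℝ^N₊. -/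

import Mathlib

open MeasureTheory Filter Set

/-- The Euclidean Laplacian: the sum of the second partial derivatives. -/
noncomputable def lap {N : ℕ} (u : EuclideanSpace ℝ (Fin N) → ℝ)
    (x : EuclideanSpace ℝ (Fin N)) : ℝ :=
  ∑ i : Fin N,
    fderiv ℝ (fun y => fderiv ℝ u y (EuclideanSpace.single i 1)) x (EuclideanSpace.single i 1)

/-- ψ(s) = ∫₀ˢ exp(−∫_α^t h(r) dr) dt. -/
noncomputable def psi (h : ℝ → ℝ) (α s : ℝ) : ℝ :=
  ∫ t in (0:ℝ)..s, Real.exp (-∫ r in α..t, h r)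

/-- ψ'(s) = exp(−∫_α^s h(r) dr). -/
noncomputable def psi' (h : ℝ → ℝ) (α s : ℝ) : ℝ :=
  Real.exp (-∫ r in α..s, h r)

/-- The critical Sobolev exponent 2* = 2N/(N−2). -/
noncomputable def twoStar (N : ℕ) : ℝ := 2 * N / ((N : ℝ) - 2)

open Topology

/-- `f` is differentiable near `0` with derivative `f'`, and `f'` has derivative `f''` at `0`. -/
def HasDeriv2 {F : Type*} [NormedAddCommGroup F] [NormedSpace ℝ F]
    (f f' : ℝ → F) (f'' : F) : Prop :=
  (∀ᶠ s in 𝓝 (0 : ℝ), HasDerivAt f (f' s) s) ∧ HasDerivAt f' f'' 0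

namespace HasDeriv2

variable {F : Type*} [NormedAddCommGroup F] [NormedSpace ℝ F]

lemma add {f f' g g' : ℝ → F} {f'' g'' : F} (hf : HasDeriv2 f f' f'') (hg : HasDeriv2 g g' g'') :
    HasDeriv2 (fun s => f s + g s) (fun s => f' s + g' s) (f'' + g'') :=
  ⟨by filter_upwards [hf.1, hg.1] with s h1 h2 using h1.add h2, hf.2.add hg.2⟩

lemma sub {f f' g g' : ℝ → F} {f'' g'' : F} (hf : HasDeriv2 f f' f'') (hg : HasDeriv2 g g' g'') :
    HasDeriv2 (fun s => f s - g s) (fun s => f' s - g' s) (f'' - g'') :=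
  ⟨by filter_upwards [hf.1, hg.1] with s h1 h2 using h1.sub h2, hf.2.sub hg.2⟩

lemma const (c : F) : HasDeriv2 (fun _ => c) (fun _ => 0) 0 :=
  ⟨Eventually.of_forall fun s => hasDerivAt_const s c, hasDerivAt_const _ _⟩

lemma line (y e : F) : HasDeriv2 (fun s : ℝ => y + s • e) (fun _ => e) 0 := by
  refine ⟨Eventually.of_forall fun s => ?_, hasDerivAt_const _ _⟩
  simpa using ((hasDerivAt_id s).smul_const e).const_add y

lemma smul {f f' : ℝ → ℝ} {f'' : ℝ} {g g' : ℝ → F} {g'' : F} (hf : HasDeriv2 f f' f'')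
    (hg : HasDeriv2 g g' g'') :
    HasDeriv2 (fun s => f s • g s) (fun s => f s • g' s + f' s • g s)
      (f 0 • g'' + (2 * f' 0) • g' 0 + f'' • g 0) := by
  refine ⟨by filter_upwards [hf.1, hg.1] with s h1 h2 using h1.smul h2, ?_⟩
  refine ((hf.1.self_of_nhds.smul hg.2).add (hf.2.smul hg.1.self_of_nhds)).congr_deriv ?_
  rw [two_mul, add_smul]
  abel

lemma mul {f f' g g' : ℝ → ℝ} {f'' g'' : ℝ} (hf : HasDeriv2 f f' f'') (hg : HasDeriv2 g g' g'') :
    HasDeriv2 (fun s => f s * g s) (fun s => f s * g' s + f' s * g s)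
      (f 0 * g'' + 2 * f' 0 * g' 0 + f'' * g 0) :=
  hf.smul hg

lemma continuousAt {f f' : ℝ → F} {f'' : F} (hf : HasDeriv2 f f' f'') :
    ContinuousAt f 0 := hf.1.self_of_nhds.continuousAt

/-- Chain rule for second derivatives along curves. -/
lemma comp {v : F → ℝ} {γ γ' : ℝ → F} {γ'' : F} (hγ : HasDeriv2 γ γ' γ'')
    (hv : ContDiffAt ℝ 2 v (γ 0)) :
    HasDeriv2 (fun s => v (γ s)) (fun s => fderiv ℝ v (γ s) (γ' s))
      (fderiv ℝ (fderiv ℝ v) (γ 0) (γ' 0) (γ' 0) + fderiv ℝ v (γ 0) γ'') := by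
  have hd : ∀ᶠ x in 𝓝 (γ 0), DifferentiableAt ℝ v x := by
    filter_upwards [hv.eventually (by simp)] with x hx using hx.differentiableAt (by norm_num)
  have h1 : DifferentiableAt ℝ (fderiv ℝ v) (γ 0) :=
    (hv.fderiv_right (m := 1) (by norm_num)).differentiableAt (by norm_num)
  refine ⟨?_, ?_⟩
  · filter_upwards [hγ.1, hγ.1.self_of_nhds.continuousAt.eventually hd] with s h1 h2
    exact h2.hasFDerivAt.comp_hasDerivAt s h1
  · exact (h1.hasFDerivAt.comp_hasDerivAt (0 : ℝ) hγ.1.self_of_nhds).clm_apply hγ.2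

/-- Chain rule for second derivatives of real functions. -/
lemma comp_real {φ φ' : ℝ → ℝ} {φ'' : ℝ} {g g' : ℝ → ℝ} {g'' : ℝ} (hg : HasDeriv2 g g' g'')
    (h1 : ∀ᶠ t in 𝓝 (g 0), HasDerivAt φ (φ' t) t) (h2 : HasDerivAt φ' φ'' (g 0)) :
    HasDeriv2 (fun s => φ (g s)) (fun s => φ' (g s) * g' s)
      (φ'' * g' 0 ^ 2 + φ' (g 0) * g'') := by
  refine ⟨?_, ?_⟩
  · filter_upwards [hg.1, hg.1.self_of_nhds.continuousAt.eventually h1] with s h3 h4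
    exact h4.comp s h3
  · refine ((h2.comp (0 : ℝ) hg.1.self_of_nhds).mul hg.2).congr_deriv ?_
    simp only [Function.comp]
    ring

lemma nonneg_of_isLocalMin {f f' : ℝ → ℝ} {f'' : ℝ} (hf : HasDeriv2 f f' f'')
    (hmin : IsLocalMin f 0) : 0 ≤ f'' := by
  by_contra! hneg
  have hd : deriv f =ᶠ[𝓝 0] f' := by
    filter_upwards [hf.1] with s hs using hs.deriv
  have hdd : deriv (deriv f) 0 = f'' := by rw [hd.deriv_eq, hf.2.deriv]
  have hmax : IsLocalMax f 0 :=
    isLocalMax_of_deriv_deriv_neg (by rwa [hdd]) hmin.deriv_eq_zero hf.continuousAt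
  have hc : f =ᶠ[𝓝 0] fun _ => f 0 := by
    filter_upwards [hmin, hmax] with s h1 h2 using le_antisymm h2 h1
  have : deriv f =ᶠ[𝓝 0] fun _ => 0 := by
    filter_upwards [hc.eventuallyEq_nhds] with s hs
    rw [hs.deriv_eq, deriv_const]
  rw [this.deriv_eq, deriv_const] at hdd
  exact hneg.ne hdd.symm

lemma unique {f f' f₁' : ℝ → F} {f'' f₁'' : F} (hf : HasDeriv2 f f' f'')
    (hf₁ : HasDeriv2 f f₁' f₁'') : f'' = f₁'' := by
  have : f' =ᶠ[𝓝 0] f₁' := by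
    filter_upwards [hf.1, hf₁.1] with s h1 h2 using h1.unique h2
  exact hf.2.unique (hf₁.2.congr_of_eventuallyEq this)

end HasDeriv2

/-- The unit vectors of the standard basis. -/
noncomputable abbrev stdVec {n : ℕ} (i : Fin n) : EuclideanSpace ℝ (Fin n) :=
  EuclideanSpace.single i 1

/-- The Laplacian as the trace of the second Fréchet derivative. -/
noncomputable def traceHess {n : ℕ} (v : EuclideanSpace ℝ (Fin n) → ℝ)
    (x : EuclideanSpace ℝ (Fin n)) : ℝ :=
  ∑ i : Fin n, fderiv ℝ (fderiv ℝ v) x (stdVec i) (stdVec i)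

lemma sum_smul_stdVec {n : ℕ} (y : EuclideanSpace ℝ (Fin n)) : ∑ i, y i • stdVec i = y := by
  ext j
  simp [Finset.sum_apply, stdVec, Pi.single_apply]

lemma sum_sq_eq_norm_sq {n : ℕ} (y : EuclideanSpace ℝ (Fin n)) : ∑ i, y i ^ 2 = ‖y‖ ^ 2 := by
  rw [EuclideanSpace.real_norm_sq_eq]

/-- The Kelvin transform on the sphere of radius `√κ` centred at the origin. -/
noncomputable def kelvin {n : ℕ} (b κ : ℝ) (v : EuclideanSpace ℝ (Fin n) → ℝ)
    (y : EuclideanSpace ℝ (Fin n)) : ℝ :=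
  (κ / ‖y‖ ^ 2) ^ b * v ((κ / ‖y‖ ^ 2) • y)

lemma hasDeriv2_norm_sq {n : ℕ} (y : EuclideanSpace ℝ (Fin n)) (i : Fin n) :
    HasDeriv2 (fun s : ℝ => ‖y + s • stdVec i‖ ^ 2) (fun s => 2 * y i + 2 * s) 2 := by
  have h : (fun s : ℝ => ‖y + s • stdVec i‖ ^ 2) = fun s => ‖y‖ ^ 2 + 2 * y i * s + s ^ 2 := by
    ext s
    rw [norm_add_sq_real, norm_smul, inner_smul_right]
    simp [stdVec, EuclideanSpace.inner_single_right]
    ring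
  rw [h]
  refine ⟨Eventually.of_forall fun s => ?_, ?_⟩
  · have := (((hasDerivAt_id s).const_mul (2 * y i)).const_add (‖y‖ ^ 2)).add
      ((hasDerivAt_id s).pow 2)
    refine this.congr_deriv ?_
    simp
  · simpa using ((hasDerivAt_id (0 : ℝ)).const_mul 2).const_add (2 * y i)

lemma hasDeriv2_kelvin_factor {n : ℕ} (κ : ℝ) {y : EuclideanSpace ℝ (Fin n)} (hy : y ≠ 0)
    (i : Fin n) :
    ∃ q' : ℝ → ℝ, q' 0 = -2 * κ * y i / ‖y‖ ^ 4 ∧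
      HasDeriv2 (fun s : ℝ => κ / ‖y + s • stdVec i‖ ^ 2) q'
        (-2 * κ / ‖y‖ ^ 4 + 8 * κ * y i ^ 2 / ‖y‖ ^ 6) := by
  have hr : ‖y‖ ≠ 0 := norm_ne_zero_iff.2 hy
  have h := (hasDeriv2_norm_sq y i).comp_real (φ := fun t => κ / t) (φ' := fun t => -κ / t ^ 2)
    (φ'' := 2 * κ / (‖y‖ ^ 2) ^ 3) ?_ ?_
  · refine ⟨fun s => -κ / (‖y + s • stdVec i‖ ^ 2) ^ 2 * (2 * y i + 2 * s), ?_, ?_⟩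
    · simp
      field_simp
    · convert h using 1
      simp
      field_simp
      ring
  · simp only [zero_smul, add_zero]
    filter_upwards [eventually_ne_nhds (pow_ne_zero 2 hr)] with t ht
    refine ((hasDerivAt_inv ht).const_mul κ).congr_deriv ?_
    field_simp
  · simp only [zero_smul, add_zero]
    have h2 : ‖y‖ ^ 2 ≠ 0 := pow_ne_zero 2 hr
    refine (((hasDerivAt_pow 2 (‖y‖ ^ 2)).inv (pow_ne_zero 2 h2)).const_mul (-κ)).congr_deriv ?_
    push_cast
    field_simp

/-- The Laplacian of the Kelvin transform. -/
lemma hasDeriv2_kelvin {n : ℕ} {b κ : ℝ} (hb : 2 * b = n - 2) (hκ : 0 < κ)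
    {v : EuclideanSpace ℝ (Fin n) → ℝ} {y : EuclideanSpace ℝ (Fin n)} (hy : y ≠ 0)
    (hv : ContDiffAt ℝ 2 v ((κ / ‖y‖ ^ 2) • y)) :
    ∃ (D : Fin n → ℝ → ℝ) (D2 : Fin n → ℝ),
      (∀ i, HasDeriv2 (fun s : ℝ => kelvin b κ v (y + s • stdVec i)) (D i) (D2 i)) ∧
      ∑ i, D2 i = (κ / ‖y‖ ^ 2) ^ (b + 2) * traceHess v ((κ / ‖y‖ ^ 2) • y) := by
  have hr : 0 < ‖y‖ := norm_pos_iff.2 hy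
  have hc : 0 < κ / ‖y‖ ^ 2 := by positivity
  choose q' hq'0 hq using fun i => hasDeriv2_kelvin_factor κ hy i
  have hpow : ∀ i, HasDeriv2 (fun s : ℝ => (κ / ‖y + s • stdVec i‖ ^ 2) ^ b) _ _ := fun i =>
    (hq i).comp_real (φ := fun t => t ^ b) (φ' := fun t => b * t ^ (b - 1))
      (φ'' := b * ((b - 1) * (κ / ‖y‖ ^ 2) ^ (b - 1 - 1)))
      (by
        simp only [zero_smul, add_zero]
        filter_upwards [eventually_ne_nhds hc.ne'] with t ht
        exact Real.hasDerivAt_rpow_const (Or.inl ht))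
      (by
        simp only [zero_smul, add_zero]
        exact (Real.hasDerivAt_rpow_const (Or.inl hc.ne')).const_mul b)
  have hcurve : ∀ i, HasDeriv2
      (fun s : ℝ => (κ / ‖y + s • stdVec i‖ ^ 2) • (y + s • stdVec i)) _ _ := fun i =>
    (hq i).smul (HasDeriv2.line y (stdVec i))
  have hcomp : ∀ i, HasDeriv2
      (fun s : ℝ => v ((κ / ‖y + s • stdVec i‖ ^ 2) • (y + s • stdVec i))) _ _ := fun i =>
    (hcurve i).comp (by simpa using hv)
  refine ⟨_, _, fun i => (hpow i).mul (hcomp i), ?_⟩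
  simp only [zero_smul, add_zero, smul_zero, zero_add, hq'0]
  set x := (κ / ‖y‖ ^ 2) • y with hx
  set L := fderiv ℝ v x
  set H := fderiv ℝ (fderiv ℝ v) x
  set c := κ / ‖y‖ ^ 2 with hcdef
  have hLy : ∑ i, y i * L (stdVec i) = L y := by
    conv_rhs => rw [← sum_smul_stdVec y]
    simp [map_sum]
  have hHy1 : ∑ i, y i * H (stdVec i) y = H y y := by
    calc ∑ i, y i * H (stdVec i) y = H (∑ i, y i • stdVec i) y := by
          simp [map_sum]
      _ = H y y := by rw [sum_smul_stdVec]
  have hHy2 : ∑ i, y i * H y (stdVec i) = H y y := by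
    calc ∑ i, y i * H y (stdVec i) = H y (∑ i, y i • stdVec i) := by simp [map_sum]
      _ = H y y := by rw [sum_smul_stdVec]
  have hsq := sum_sq_eq_norm_sq y
  have hP1 : c ^ (b - 1) = c ^ b / c := by rw [Real.rpow_sub_one hc.ne']
  have hP2 : c ^ (b - 1 - 1) = c ^ b / c / c := by
    rw [Real.rpow_sub_one hc.ne', Real.rpow_sub_one hc.ne']
  have hP3 : c ^ (b + 2) = c ^ b * c ^ 2 := by
    rw [Real.rpow_add hc]
    norm_num
  have hn : (n : ℝ) = 2 * b + 2 := by linarith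
  have hterm : ∀ i, c ^ b * (H ((c • stdVec i) + (-2 * κ * y i / ‖y‖ ^ 4) • y)
      ((c • stdVec i) + (-2 * κ * y i / ‖y‖ ^ 4) • y) +
      L ((2 * (-2 * κ * y i / ‖y‖ ^ 4)) • stdVec i +
        (-2 * κ / ‖y‖ ^ 4 + 8 * κ * y i ^ 2 / ‖y‖ ^ 6) • y)) +
      2 * (b * c ^ (b - 1) * (-2 * κ * y i / ‖y‖ ^ 4)) *
        L (c • stdVec i + (-2 * κ * y i / ‖y‖ ^ 4) • y) +
      (b * ((b - 1) * c ^ (b - 1 - 1)) * (-2 * κ * y i / ‖y‖ ^ 4) ^ 2 +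
        b * c ^ (b - 1) * (-2 * κ / ‖y‖ ^ 4 + 8 * κ * y i ^ 2 / ‖y‖ ^ 6)) * v x =
      c ^ b * c ^ 2 * H (stdVec i) (stdVec i)
      + (-2 * κ ^ 2 / ‖y‖ ^ 6 * c ^ b) * (y i * H (stdVec i) y)
      + (-2 * κ ^ 2 / ‖y‖ ^ 6 * c ^ b) * (y i * H y (stdVec i))
      + (4 * κ ^ 2 / ‖y‖ ^ 8 * c ^ b * H y y) * y i ^ 2
      + (-4 * κ / ‖y‖ ^ 4 * (1 + b) * c ^ b) * (y i * L (stdVec i))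
      + (-2 * κ / ‖y‖ ^ 4 * c ^ b * L y + -2 * b * c ^ b / ‖y‖ ^ 2 * v x)
      + (8 * κ / ‖y‖ ^ 6 * c ^ b * (1 + b) * L y + c ^ b * (4 * b * (b + 1)) / ‖y‖ ^ 4 * v x)
        * y i ^ 2 := by
    intro i
    simp only [map_add, map_smul, _root_.add_apply, _root_.smul_apply,
      smul_eq_mul, hP1, hP2]
    rw [hcdef]
    field_simp
    ring
  rw [Finset.sum_congr rfl fun i _ => hterm i]
  simp only [Finset.sum_add_distrib, ← Finset.mul_sum, hHy1, hHy2, hLy, hsq, Finset.sum_const,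
    Finset.card_univ, Fintype.card_fin, nsmul_eq_mul]
  rw [hP3, hn, traceHess, hcdef]
  field_simp
  ring

/-- A positive classical solution `v` of `-Δ v = g` in the half-space with zero boundary values,
whose right-hand side is comparable to a strictly subcritical nonlinearity of `v`. -/
structure IsSubcriticalSol (m : ℕ) (b : ℝ) (v g : EuclideanSpace ℝ (Fin (m + 1)) → ℝ) : Prop where
  cont : ContinuousOn v {x | 0 ≤ x (Fin.last m)}
  zero : ∀ x : EuclideanSpace ℝ (Fin (m + 1)), x (Fin.last m) = 0 → v x = 0
  smooth : ContDiffOn ℝ 2 v {x | 0 < x (Fin.last m)}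
  pos : ∀ x : EuclideanSpace ℝ (Fin (m + 1)), 0 < x (Fin.last m) → 0 < v x
  eq : ∀ x : EuclideanSpace ℝ (Fin (m + 1)), 0 < x (Fin.last m) → traceHess v x = -g x
  comp : ∀ M : ℝ, ∃ C : ℝ, 0 ≤ C ∧ ∀ x y : EuclideanSpace ℝ (Fin (m + 1)),
    0 < x (Fin.last m) → 0 < y (Fin.last m) → v x ≤ M → ∀ c : ℝ, 1 ≤ c → c ^ b * v y ≤ v x →
      g x ≤ c ^ (b + 2) * g y + C * (v x - c ^ b * v y)
  strict : ∀ x y : EuclideanSpace ℝ (Fin (m + 1)), 0 < x (Fin.last m) → 0 < y (Fin.last m) →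
    ∀ c : ℝ, 1 < c → c ^ b * v y = v x → g x < c ^ (b + 2) * g y
  mono : ∀ x y : EuclideanSpace ℝ (Fin (m + 1)), 0 < x (Fin.last m) → 0 < y (Fin.last m) →
    v y ≤ v x → g y ≤ g x
  source_pos : ∀ x : EuclideanSpace ℝ (Fin (m + 1)), 0 < x (Fin.last m) → 0 < g x

lemma continuous_last (m : ℕ) :
    Continuous fun x : EuclideanSpace ℝ (Fin (m + 1)) => x (Fin.last m) := by
  fun_prop

lemma ne_zero_of_last_pos {m : ℕ} {x : EuclideanSpace ℝ (Fin (m + 1))}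
    (hx : 0 < x (Fin.last m)) : x ≠ 0 := by
  rintro rfl
  simp at hx

/-- A positive superharmonic function, very superharmonic near the hyperplane and near the sphere
`‖y‖ ^ 2 = κ`. -/
noncomputable def barrier {m : ℕ} (A κ : ℝ) (y : EuclideanSpace ℝ (Fin (m + 1))) : ℝ :=
  4 - Real.exp (-(A * y (Fin.last m))) - Real.exp (A * (‖y‖ ^ 2 - κ))

lemma barrier_mem_Icc {m : ℕ} {A κ : ℝ} (hA : 0 < A) {y : EuclideanSpace ℝ (Fin (m + 1))}
    (hy : 0 ≤ y (Fin.last m)) (hyκ : ‖y‖ ^ 2 ≤ κ) : barrier A κ y ∈ Icc (2 : ℝ) 4 := by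
  have h1 : Real.exp (-(A * y (Fin.last m))) ≤ 1 := by
    rw [Real.exp_le_one_iff]
    have := mul_nonneg hA.le hy
    linarith
  have h2 : Real.exp (A * (‖y‖ ^ 2 - κ)) ≤ 1 := by
    rw [Real.exp_le_one_iff]
    exact mul_nonpos_of_nonneg_of_nonpos hA.le (by linarith)
  have h3 := Real.exp_pos (-(A * y (Fin.last m)))
  have h4 := Real.exp_pos (A * (‖y‖ ^ 2 - κ))
  constructor <;> unfold barrier <;> linarith

lemma continuous_barrier {m : ℕ} (A κ : ℝ) : Continuous (barrier (m := m) A κ) := by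
  unfold barrier
  fun_prop

lemma hasDeriv2_barrier {m : ℕ} (A κ : ℝ) (hA : 0 < A) (y : EuclideanSpace ℝ (Fin (m + 1))) :
    ∃ (D : Fin (m + 1) → ℝ → ℝ) (D2 : Fin (m + 1) → ℝ),
      (∀ i, HasDeriv2 (fun s : ℝ => barrier A κ (y + s • stdVec i)) (D i) (D2 i)) ∧
      ∑ i, D2 i ≤ -(A ^ 2 * Real.exp (-(A * y (Fin.last m))) +
        2 * A * Real.exp (A * (‖y‖ ^ 2 - κ))) := by
  have hexp : ∀ {f f' : ℝ → ℝ} {f'' : ℝ}, HasDeriv2 f f' f'' →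
      HasDeriv2 (fun s => Real.exp (f s)) (fun s => Real.exp (f s) * f' s)
        (Real.exp (f 0) * f' 0 ^ 2 + Real.exp (f 0) * f'') := fun h =>
    h.comp_real (Eventually.of_forall fun t => Real.hasDerivAt_exp t) (Real.hasDerivAt_exp _)
  have h1 : ∀ i, HasDeriv2 (fun s : ℝ => -(A * (y + s • stdVec i) (Fin.last m)))
      (fun _ => -(A * stdVec i (Fin.last m))) 0 := by
    intro i
    refine ⟨Eventually.of_forall fun s => ?_, hasDerivAt_const _ _⟩
    have := (((hasDerivAt_id s).mul_const (stdVec i (Fin.last m))).const_add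
      (y (Fin.last m))).const_mul A |>.neg
    exact (show HasDerivAt (fun t : ℝ => -(A * (y + t • stdVec i) (Fin.last m))) _ s
      from this).congr_deriv (by simp)
  have h2 : ∀ i, HasDeriv2 (fun s : ℝ => A * (‖y + s • stdVec i‖ ^ 2 - κ))
      (fun s => A * (2 * y i + 2 * s)) (A * 2) := by
    intro i
    obtain ⟨h3, h4⟩ := hasDeriv2_norm_sq y i
    refine ⟨?_, h4.const_mul A⟩
    filter_upwards [h3] with s hs using (hs.sub_const κ).const_mul A
  refine ⟨_, _, fun i => ((HasDeriv2.const 4).sub (hexp (h1 i))).sub (hexp (h2 i)), ?_⟩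
  simp only [zero_smul, add_zero, mul_zero, zero_sub, Finset.sum_sub_distrib,
    Finset.sum_neg_distrib, ← Finset.mul_sum, Finset.sum_add_distrib]
  have h3 : ∑ i : Fin (m + 1), (-(A * stdVec i (Fin.last m))) ^ 2 = A ^ 2 := by
    rw [Finset.sum_eq_single (Fin.last m)]
    · simp [stdVec]
    · intro i _ hi
      simp [stdVec, hi.symm]
    · simp
  have h4 : 0 ≤ ∑ i : Fin (m + 1), (A * (2 * y i)) ^ 2 := Finset.sum_nonneg fun i _ => sq_nonneg _
  rw [h3]
  simp only [Finset.sum_const, Finset.card_univ, Fintype.card_fin, nsmul_eq_mul]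
  have h5 := Real.exp_pos (A * (‖y‖ ^ 2 - κ))
  have h6 : 0 ≤ Real.exp (A * (‖y‖ ^ 2 - κ)) * ∑ i : Fin (m + 1), (A * (2 * y i)) ^ 2 :=
    mul_nonneg h5.le h4
  have h7 : 0 ≤ (m : ℝ) * (Real.exp (A * (‖y‖ ^ 2 - κ)) * A) := by positivity
  push_cast
  nlinarith

lemma continuousOn_kelvin {m : ℕ} {b : ℝ} {v : EuclideanSpace ℝ (Fin (m + 1)) → ℝ}
    (hv : ContinuousOn v {x | 0 ≤ x (Fin.last m)}) :
    ContinuousOn (fun p : ℝ × EuclideanSpace ℝ (Fin (m + 1)) => kelvin b p.1 v p.2)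
      {p | 0 < p.1 ∧ 0 ≤ p.2 (Fin.last m) ∧ p.2 ≠ 0} := by
  have hc : ContinuousOn (fun p : ℝ × EuclideanSpace ℝ (Fin (m + 1)) => p.1 / ‖p.2‖ ^ 2)
      {p | 0 < p.1 ∧ 0 ≤ p.2 (Fin.last m) ∧ p.2 ≠ 0} := by
    refine ContinuousOn.div (by fun_prop) (by fun_prop) fun p hp => ?_
    exact pow_ne_zero 2 (norm_ne_zero_iff.2 hp.2.2)
  have hpos : ∀ p ∈ {p : ℝ × EuclideanSpace ℝ (Fin (m + 1)) |
      0 < p.1 ∧ 0 ≤ p.2 (Fin.last m) ∧ p.2 ≠ 0}, 0 < p.1 / ‖p.2‖ ^ 2 := fun p hp =>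
    div_pos hp.1 (pow_pos (norm_pos_iff.2 hp.2.2) 2)
  unfold kelvin
  refine (hc.rpow_const fun p hp => Or.inl (hpos p hp).ne').mul
    (hv.comp (hc.smul continuousOn_snd) fun p hp => ?_)
  simpa using mul_nonneg (hpos p hp).le hp.2.1

namespace IsSubcriticalSol

variable {m : ℕ} {b : ℝ} {v g : EuclideanSpace ℝ (Fin (m + 1)) → ℝ}

lemma contDiffAt (S : IsSubcriticalSol m b v g) {x : EuclideanSpace ℝ (Fin (m + 1))}
    (hx : 0 < x (Fin.last m)) : ContDiffAt ℝ 2 v x :=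
  S.smooth.contDiffAt ((isOpen_lt continuous_const (continuous_last m)).mem_nhds hx)

/-- The differential inequality at a local minimum of `kelvin b κ v - v + μ • barrier A κ`. -/
lemma le_of_isLocalMin (S : IsSubcriticalSol m b v g) (hb : 2 * b = m - 1) {κ μ A : ℝ}
    (hκ : 0 < κ) (hμ : 0 ≤ μ) (hA : 0 < A) {x : EuclideanSpace ℝ (Fin (m + 1))}
    (hx : 0 < x (Fin.last m))
    (hmin : IsLocalMin (fun y => kelvin b κ v y - v y + μ * barrier A κ y) x) :
    μ * (A ^ 2 * Real.exp (-(A * x (Fin.last m))) + 2 * A * Real.exp (A * (‖x‖ ^ 2 - κ))) ≤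
      g x - (κ / ‖x‖ ^ 2) ^ (b + 2) * g ((κ / ‖x‖ ^ 2) • x) := by
  have hx0 := ne_zero_of_last_pos hx
  have hc : 0 < κ / ‖x‖ ^ 2 := div_pos hκ (pow_pos (norm_pos_iff.2 hx0) 2)
  have hcx : 0 < ((κ / ‖x‖ ^ 2) • x) (Fin.last m) := by simpa using mul_pos hc hx
  obtain ⟨D, D2, hD, hDs⟩ := hasDeriv2_kelvin (n := m + 1) (b := b) (by push_cast; linarith) hκ hx0
    (S.contDiffAt hcx)
  obtain ⟨B, B2, hB, hBs⟩ := hasDeriv2_barrier A κ hA x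
  have hV : ∀ i, HasDeriv2 (fun s : ℝ => v (x + s • stdVec i)) _ _ := fun i =>
    (HasDeriv2.line x (stdVec i)).comp (by simpa using S.contDiffAt hx)
  have hnn := fun i => HasDeriv2.nonneg_of_isLocalMin
    (((hD i).sub (hV i)).add ((HasDeriv2.const μ).mul (hB i))) (by
      have hcont : ContinuousAt (fun s : ℝ => x + s • (stdVec i : EuclideanSpace ℝ (Fin (m + 1)))) 0 := by
        fun_prop
      have := IsLocalMin.comp_continuous (g := fun s : ℝ => x + s • stdVec i) (b := (0 : ℝ))
        (by simpa using hmin) hcont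
      exact this)
  have hsum := Finset.sum_nonneg fun i (_ : i ∈ Finset.univ) => hnn i
  simp only [zero_smul, add_zero, map_zero, zero_mul, mul_zero, Finset.sum_add_distrib,
    Finset.sum_sub_distrib, ← Finset.mul_sum] at hsum
  have h1 := S.eq x hx
  rw [traceHess] at h1
  rw [hDs, h1, S.eq _ hcx] at hsum
  nlinarith [mul_le_mul_of_nonneg_left hBs hμ]

/-- If `kelvin b κ v > v` away from the boundary of the half-ball, then `kelvin b κ v ≥ v`
on the half-ball: a maximum principle in narrow domains. -/
lemma le_kelvin_of_core (S : IsSubcriticalSol m b v g) (hb : 2 * b = m - 1) {κ M C A : ℝ}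
    (hκ : 0 < κ) (hM : ∀ y : EuclideanSpace ℝ (Fin (m + 1)), 0 ≤ y (Fin.last m) →
      ‖y‖ ^ 2 ≤ κ → v y ≤ M)
    (hC : 0 ≤ C) (hcomp : ∀ x y : EuclideanSpace ℝ (Fin (m + 1)),
      0 < x (Fin.last m) → 0 < y (Fin.last m) → v x ≤ M → ∀ c : ℝ, 1 ≤ c → c ^ b * v y ≤ v x →
        g x ≤ c ^ (b + 2) * g y + C * (v x - c ^ b * v y))
    (hA : 1 ≤ A) (hAC : 12 * C < A)
    (hcore : ∀ y : EuclideanSpace ℝ (Fin (m + 1)), 1 / A ≤ y (Fin.last m) →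
      ‖y‖ ^ 2 ≤ κ - 1 / A → v y < kelvin b κ v y)
    {y : EuclideanSpace ℝ (Fin (m + 1))} (hy : 0 < y (Fin.last m)) (hyκ : ‖y‖ ^ 2 ≤ κ) :
    v y ≤ kelvin b κ v y := by
  by_contra! hlt
  have hA0 : 0 < A := by linarith
  have hφ := fun {z : EuclideanSpace ℝ (Fin (m + 1))} (h1 : 0 ≤ z (Fin.last m))
    (h2 : ‖z‖ ^ 2 ≤ κ) => barrier_mem_Icc hA0 h1 h2
  have hφy := hφ hy.le hyκ
  set η := (v y - kelvin b κ v y) / barrier A κ y with hη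
  have hη0 : 0 < η := div_pos (by linarith) (by linarith [hφy.1])
  have hkpos : ∀ z : EuclideanSpace ℝ (Fin (m + 1)), 0 < z (Fin.last m) → 0 < kelvin b κ v z := by
    intro z hz
    have hc : 0 < κ / ‖z‖ ^ 2 := div_pos hκ (pow_pos (norm_pos_iff.2 (ne_zero_of_last_pos hz)) 2)
    exact mul_pos (Real.rpow_pos_of_pos hc b) (S.pos _ (by simpa using mul_pos hc hz))
  set D : Set (EuclideanSpace ℝ (Fin (m + 1))) :=
    ({z | 0 ≤ z (Fin.last m)} ∩ v ⁻¹' Ici (2 * η)) ∩ {z | ‖z‖ ^ 2 ≤ κ} with hD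
  have hDclosed : IsClosed D :=
    (S.cont.preimage_isClosed_of_isClosed (isClosed_le continuous_const (continuous_last m))
      isClosed_Ici).inter (isClosed_le (by fun_prop) continuous_const)
  have hDcomp : IsCompact D := by
    refine (isCompact_closedBall (0 : EuclideanSpace ℝ (Fin (m + 1))) (Real.sqrt κ)).of_isClosed_subset
      hDclosed fun z hz => ?_
    simpa using Real.le_sqrt_of_sq_le hz.2
  have hDpos : ∀ z ∈ D, 0 < z (Fin.last m) := by
    intro z hz
    refine lt_of_le_of_ne hz.1.1 fun h0 => ?_
    have h1 : 2 * η ≤ v z := hz.1.2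
    rw [S.zero z h0.symm] at h1
    linarith
  have hyD : y ∈ D := by
    refine ⟨⟨hy.le, ?_⟩, hyκ⟩
    have h1 : η * barrier A κ y = v y - kelvin b κ v y :=
      div_mul_cancel₀ _ (by linarith [hφy.1])
    have h2 := mul_le_mul_of_nonneg_left hφy.1 hη0.le
    have h3 := hkpos y hy
    show 2 * η ≤ v y
    linarith
  have hcont : ContinuousOn (fun z => (kelvin b κ v z - v z) / barrier A κ z) D := by
    refine ContinuousOn.div (ContinuousOn.sub ?_ (S.cont.mono fun z hz => hz.1.1))
      (continuous_barrier A κ).continuousOn fun z hz => ?_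
    · exact (continuousOn_kelvin (b := b) S.cont).comp
        (f := fun z : EuclideanSpace ℝ (Fin (m + 1)) => (κ, z)) (by fun_prop)
        fun z hz => ⟨hκ, hz.1.1, ne_zero_of_last_pos (hDpos z hz)⟩
    · linarith [(hφ hz.1.1 hz.2).1]
  obtain ⟨P, hPD, hPmin⟩ := hDcomp.exists_isMinOn ⟨y, hyD⟩ hcont
  have hP := hDpos P hPD
  have hφP := hφ hP.le hPD.2
  set μ := -((kelvin b κ v P - v P) / barrier A κ P) with hμ
  have hμη : η ≤ μ := by
    have h1 : (kelvin b κ v P - v P) / barrier A κ P ≤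
      (kelvin b κ v y - v y) / barrier A κ y := hPmin hyD
    have h2 : (kelvin b κ v y - v y) / barrier A κ y = -η := by rw [hη]; ring
    linarith
  have hPz : v P - kelvin b κ v P = μ * barrier A κ P := by
    have : barrier A κ P ≠ 0 := by linarith [hφP.1]
    rw [hμ]
    field_simp
    ring
  have hPneg : kelvin b κ v P < v P := by
    have := mul_pos (hη0.trans_le hμη) (by linarith [hφP.1] : 0 < barrier A κ P)
    linarith
  have hPr : 0 < ‖P‖ ^ 2 := pow_pos (norm_pos_iff.2 (ne_zero_of_last_pos hP)) 2
  have hPκ : ‖P‖ ^ 2 < κ := by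
    refine lt_of_le_of_ne hPD.2 fun h => ?_
    have : kelvin b κ v P = v P := by
      rw [kelvin, h, div_self hκ.ne', Real.one_rpow, one_smul, one_mul]
    linarith
  have hmin : IsLocalMin (fun z => kelvin b κ v z - v z + μ * barrier A κ z) P := by
    have h1 : ∀ᶠ z in 𝓝 P, 0 < z (Fin.last m) :=
      (isOpen_lt continuous_const (continuous_last m)).mem_nhds hP
    have h2 : ∀ᶠ z : EuclideanSpace ℝ (Fin (m + 1)) in 𝓝 P, ‖z‖ ^ 2 < κ :=
      (isOpen_lt (by fun_prop) continuous_const).mem_nhds hPκ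
    filter_upwards [h1, h2] with z hz hzκ
    have hφz := hφ hz.le hzκ.le
    have hle : -μ ≤ (kelvin b κ v z - v z) / barrier A κ z := by
      by_cases hzD : z ∈ D
      · rw [hμ, neg_neg]
        exact hPmin hzD
      · have h3 : v z < 2 * η := by
          by_contra! h3
          exact hzD ⟨⟨hz.le, h3⟩, hzκ.le⟩
        rw [le_div_iff₀ (by linarith [hφz.1])]
        nlinarith [hkpos z hz, hφz.1]
    rw [le_div_iff₀ (by linarith [hφz.1])] at hle
    linarith
  have hkey := S.le_of_isLocalMin hb hκ (hη0.le.trans hμη) hA0 hP hmin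
  have hc : 0 < κ / ‖P‖ ^ 2 := div_pos hκ hPr
  have hg := hcomp P ((κ / ‖P‖ ^ 2) • P) hP (by simpa using mul_pos hc hP) (hM P hP.le hPD.2)
    (κ / ‖P‖ ^ 2) (by rw [le_div_iff₀ hPr]; linarith) hPneg.le
  have hg' : g P ≤ (κ / ‖P‖ ^ 2) ^ (b + 2) * g ((κ / ‖P‖ ^ 2) • P) + C * (μ * barrier A κ P) := by
    rw [← hPz]
    exact hg
  have hμ0 : 0 < μ := hη0.trans_le hμη
  have h4 : C * (μ * barrier A κ P) ≤ μ * (4 * C) := by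
    have := mul_le_mul_of_nonneg_left hφP.2 (mul_nonneg hC hμ0.le)
    linarith
  have h5 : A ^ 2 * Real.exp (-(A * P (Fin.last m))) + 2 * A * Real.exp (A * (‖P‖ ^ 2 - κ)) ≤
      4 * C := by
    refine le_of_mul_le_mul_left ?_ hμ0
    linarith
  have he : (1 : ℝ) / 3 ≤ Real.exp (-1) := by
    rw [Real.exp_neg, ← one_div]
    exact one_div_le_one_div_of_le (Real.exp_pos 1) (by linarith [Real.exp_one_lt_d9])
  have h6 := Real.exp_pos (-(A * P (Fin.last m)))
  have h7 := Real.exp_pos (A * (‖P‖ ^ 2 - κ))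
  have hAA : A ≤ A ^ 2 := by nlinarith
  by_cases hs : P (Fin.last m) < 1 / A
  · have h8 : Real.exp (-1) ≤ Real.exp (-(A * P (Fin.last m))) := by
      rw [Real.exp_le_exp]
      rw [lt_div_iff₀ hA0] at hs
      linarith
    have h9 : 0 ≤ 2 * A * Real.exp (A * (‖P‖ ^ 2 - κ)) := by positivity
    nlinarith
  · have h10 : κ - 1 / A < ‖P‖ ^ 2 := by
      by_contra! h10
      exact (hcore P (not_lt.1 hs) h10).not_gt hPneg
    have h8 : Real.exp (-1) ≤ Real.exp (A * (‖P‖ ^ 2 - κ)) := by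
      rw [Real.exp_le_exp]
      have := mul_lt_mul_of_pos_left h10 hA0
      rw [mul_sub, mul_one_div_cancel hA0.ne'] at this
      linarith
    have h9 : 0 ≤ A ^ 2 * Real.exp (-(A * P (Fin.last m))) := by positivity
    nlinarith

/-- The method of moving spheres. -/
lemma le_kelvin (S : IsSubcriticalSol m b v g) (hb : 2 * b = m - 1) {Λ : ℝ} (hΛ : 0 < Λ)
    {y : EuclideanSpace ℝ (Fin (m + 1))} (hy : 0 < y (Fin.last m)) (hyΛ : ‖y‖ ^ 2 ≤ Λ) :
    v y ≤ kelvin b Λ v y := by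
  obtain ⟨M, hM⟩ : ∃ M, ∀ y : EuclideanSpace ℝ (Fin (m + 1)), 0 ≤ y (Fin.last m) →
      ‖y‖ ^ 2 ≤ Λ → v y ≤ M := by
    have hcomp : IsCompact ({z : EuclideanSpace ℝ (Fin (m + 1)) | 0 ≤ z (Fin.last m)} ∩
        {z | ‖z‖ ^ 2 ≤ Λ}) := by
      refine (isCompact_closedBall (0 : EuclideanSpace ℝ (Fin (m + 1))) (Real.sqrt Λ)).of_isClosed_subset
        ((isClosed_le continuous_const (continuous_last m)).inter
          (isClosed_le (by fun_prop) continuous_const)) fun z hz => ?_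
      simpa using Real.le_sqrt_of_sq_le hz.2
    obtain ⟨M, hM⟩ := hcomp.bddAbove_image (S.cont.mono inter_subset_left)
    exact ⟨M, fun z h1 h2 => hM (mem_image_of_mem v ⟨h1, h2⟩)⟩
  obtain ⟨C, hC, hcomp⟩ := S.comp M
  set A := 12 * C + 1 with hAdef
  have hA : 1 ≤ A := by linarith
  have hA0 : 0 < 1 / A := by positivity
  have hnarrow : ∀ κ : ℝ, 0 < κ → κ ≤ Λ → (∀ y : EuclideanSpace ℝ (Fin (m + 1)),
      1 / A ≤ y (Fin.last m) → ‖y‖ ^ 2 ≤ κ - 1 / A → v y < kelvin b κ v y) →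
      ∀ y : EuclideanSpace ℝ (Fin (m + 1)), 0 < y (Fin.last m) → ‖y‖ ^ 2 ≤ κ →
        v y ≤ kelvin b κ v y := fun κ hκ hκΛ hcore y hy hyκ =>
    S.le_kelvin_of_core hb hκ (fun z h1 h2 => hM z h1 (h2.trans hκΛ)) hC hcomp hA (by linarith)
      hcore hy hyκ
  set K₀ : Set (ℝ × EuclideanSpace ℝ (Fin (m + 1))) :=
    {p | p.1 ≤ Λ ∧ 1 / A ≤ p.2 (Fin.last m) ∧ ‖p.2‖ ^ 2 ≤ p.1 - 1 / A} with hK₀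
  have hK₀pos : ∀ p ∈ K₀, 0 < p.1 := fun p hp => by
    have := hp.2.2
    have := sq_nonneg ‖p.2‖
    linarith
  have hK₀closed : IsClosed K₀ := by
    refine (isClosed_le continuous_fst continuous_const).inter
      ((isClosed_le continuous_const ((continuous_last m).comp continuous_snd)).inter
        (isClosed_le (continuous_snd.norm.pow 2) (continuous_fst.sub continuous_const)))
  have hcont : ContinuousOn (fun p : ℝ × EuclideanSpace ℝ (Fin (m + 1)) =>
      kelvin b p.1 v p.2 - v p.2) K₀ := by
    refine ((continuousOn_kelvin S.cont).mono fun p hp => ?_).sub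
      (S.cont.comp continuousOn_snd fun p hp => (hA0.trans_le hp.2.1).le)
    exact ⟨hK₀pos p hp, (hA0.trans_le hp.2.1).le, ne_zero_of_last_pos (hA0.trans_le hp.2.1)⟩
  set K := K₀ ∩ (fun p => kelvin b p.1 v p.2 - v p.2) ⁻¹' Iic 0 with hK
  have hKcomp : IsCompact K := by
    refine ((isCompact_Icc (a := (0 : ℝ)) (b := Λ)).prod
      (isCompact_closedBall (0 : EuclideanSpace ℝ (Fin (m + 1))) (Real.sqrt Λ))).of_isClosed_subset
      (hcont.preimage_isClosed_of_isClosed hK₀closed isClosed_Iic) fun p hp => ?_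
    refine ⟨⟨(hK₀pos p hp.1).le, hp.1.1⟩, ?_⟩
    have h1 : ‖p.2‖ ^ 2 ≤ Λ := by
      have := hp.1.1
      have := hp.1.2.2
      linarith
    simpa using Real.le_sqrt_of_sq_le h1
  rcases K.eq_empty_or_nonempty with hKe | hKne
  · refine hnarrow Λ hΛ le_rfl (fun z h1 h2 => ?_) y hy hyΛ
    by_contra! h3
    have : (Λ, z) ∈ K := ⟨⟨le_rfl, h1, h2⟩, by simpa using h3⟩
    simp [hKe] at this
  obtain ⟨⟨κ, P⟩, hPK, hmin⟩ := hKcomp.exists_isMinOn hKne continuousOn_fst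
  have hκ : 0 < κ := hK₀pos _ hPK.1
  have hP : 0 < P (Fin.last m) := hA0.trans_le hPK.1.2.1
  have hPκ : ‖P‖ ^ 2 < κ := by
    have : ‖P‖ ^ 2 ≤ κ - 1 / A := hPK.1.2.2
    linarith
  have hbelow : ∀ κ' : ℝ, 0 < κ' → κ' < κ → ∀ z : EuclideanSpace ℝ (Fin (m + 1)),
      0 < z (Fin.last m) → ‖z‖ ^ 2 ≤ κ' → v z ≤ kelvin b κ' v z := by
    intro κ' h0 hlt
    have hκΛ : κ' ≤ Λ := hlt.le.trans hPK.1.1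
    refine hnarrow κ' h0 hκΛ fun z h1 h2 => ?_
    by_contra! h3
    have h4 : (κ', z) ∈ K := ⟨⟨hκΛ, h1, h2⟩, by simpa using h3⟩
    exact (show κ ≤ κ' from hmin h4).not_gt hlt
  have hat : ∀ z : EuclideanSpace ℝ (Fin (m + 1)), 0 < z (Fin.last m) → ‖z‖ ^ 2 < κ →
      v z ≤ kelvin b κ v z := by
    intro z hz hzκ
    have h1 : ContinuousOn (fun κ' : ℝ => kelvin b κ' v z) (Ioi 0) :=
      (continuousOn_kelvin (b := b) S.cont).comp (f := fun κ' : ℝ => (κ', z)) (by fun_prop)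
        fun κ' hκ' => ⟨hκ', hz.le, ne_zero_of_last_pos hz⟩
    have h2 : Tendsto (fun κ' : ℝ => kelvin b κ' v z) (𝓝[<] κ) (𝓝 (kelvin b κ v z)) :=
      ((h1.continuousAt (Ioi_mem_nhds hκ)).tendsto).mono_left nhdsWithin_le_nhds
    refine ge_of_tendsto h2 ?_
    filter_upwards [Ioo_mem_nhdsLT hzκ] with κ' h3
    exact hbelow κ' ((sq_nonneg _).trans_lt h3.1) h3.2 z hz h3.1.le
  have hPeq : kelvin b κ v P = v P := by
    have h1 : kelvin b κ v P - v P ≤ 0 := hPK.2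
    exact le_antisymm (by linarith) (hat P hP hPκ)
  have hloc : IsLocalMin (fun z => kelvin b κ v z - v z + 0 * barrier A κ z) P := by
    have h1 : ∀ᶠ z in 𝓝 P, 0 < z (Fin.last m) :=
      (isOpen_lt continuous_const (continuous_last m)).mem_nhds hP
    have h2 : ∀ᶠ z : EuclideanSpace ℝ (Fin (m + 1)) in 𝓝 P, ‖z‖ ^ 2 < κ :=
      (isOpen_lt (by fun_prop) continuous_const).mem_nhds hPκ
    filter_upwards [h1, h2] with z hz hzκ
    have := hat z hz hzκ
    rw [hPeq]
    linarith
  have hkey := S.le_of_isLocalMin hb hκ le_rfl (by linarith) hP hloc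
  have hPr : 0 < ‖P‖ ^ 2 := pow_pos (norm_pos_iff.2 (ne_zero_of_last_pos hP)) 2
  have := S.strict P ((κ / ‖P‖ ^ 2) • P) hP (by simpa using mul_pos (div_pos hκ hPr) hP)
    (κ / ‖P‖ ^ 2) (by rwa [one_lt_div hPr]) hPeq
  linarith

lemma le_rpow_mul (S : IsSubcriticalSol m b v g) (hb : 2 * b = m - 1)
    {y : EuclideanSpace ℝ (Fin (m + 1))} (hy : 0 < y (Fin.last m)) {c : ℝ} (hc : 1 ≤ c) :
    v y ≤ c ^ b * v (c • y) := by
  have hr : 0 < ‖y‖ ^ 2 := pow_pos (norm_pos_iff.2 (ne_zero_of_last_pos hy)) 2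
  have := S.le_kelvin hb (Λ := c * ‖y‖ ^ 2) (by positivity) hy (by nlinarith)
  rwa [kelvin, mul_div_cancel_right₀ _ hr.ne'] at this

end IsSubcriticalSol

namespace IsSubcriticalSol

variable {m : ℕ} {b : ℝ} {v g : EuclideanSpace ℝ (Fin (m + 1)) → ℝ}

lemma translate (S : IsSubcriticalSol m b v g) {a : EuclideanSpace ℝ (Fin (m + 1))}
    (ha : a (Fin.last m) = 0) :
    IsSubcriticalSol m b (fun x => v (x + a)) (fun x => g (x + a)) := by
  have hl : ∀ x : EuclideanSpace ℝ (Fin (m + 1)), (x + a) (Fin.last m) = x (Fin.last m) := by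
    intro x
    simp [ha]
  refine ⟨?_, ?_, ?_, ?_, ?_, ?_, ?_, ?_, ?_⟩
  · refine S.cont.comp (by fun_prop) fun x hx => ?_
    simpa [ha] using hx
  · exact fun x hx => S.zero _ ((hl x).trans hx)
  · refine S.smooth.comp (by fun_prop) fun x hx => ?_
    simpa [ha] using hx
  · exact fun x hx => S.pos _ ((hl x).symm ▸ hx)
  · intro x hx
    rw [← S.eq (x + a) (by rwa [hl]), traceHess, traceHess]
    have : fderiv ℝ (fun x => v (x + a)) = fun x => fderiv ℝ v (x + a) := by
      ext1 x
      exact fderiv_comp_add_right a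
    rw [this, fderiv_comp_add_right]
  · intro M
    obtain ⟨C, hC, h⟩ := S.comp M
    exact ⟨C, hC, fun x y hx hy => h _ _ (by rwa [hl]) (by rwa [hl])⟩
  · exact fun x y hx hy => S.strict _ _ (by rwa [hl]) (by rwa [hl])
  · exact fun x y hx hy => S.mono _ _ (by rwa [hl]) (by rwa [hl])
  · exact fun x hx => S.source_pos _ (by rwa [hl])

/-- A solution does not increase between points of equal height. -/
lemma le_of_last_eq (S : IsSubcriticalSol m b v g) (hb : 2 * b = m - 1)
    {y y' : EuclideanSpace ℝ (Fin (m + 1))} (hy : 0 < y (Fin.last m))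
    (hyy' : y' (Fin.last m) = y (Fin.last m)) : v y ≤ v y' := by
  set t := y (Fin.last m) with ht
  set e : EuclideanSpace ℝ (Fin (m + 1)) := stdVec (Fin.last m) with he
  have hel : e (Fin.last m) = 1 := by simp [he, stdVec]
  have hbound : ∀ ε : ℝ, 0 < ε → v y ≤ (1 + ε / t) ^ b * v (y' + ε • e) := by
    intro ε hε
    set z := (t / ε) • (y' - y + ε • e) with hz
    have hzl : z (Fin.last m) = t := by
      simp [hz, hyy', hel, ← ht]
      field_simp
    have hal : (y - z) (Fin.last m) = 0 := by simp [hzl, ← ht]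
    have h := (S.translate hal).le_rpow_mul hb (y := z) (by rwa [hzl]) (c := 1 + ε / t)
      (by have := div_pos hε hy; linarith)
    have h1 : z + (y - z) = y := by abel
    have h2 : (1 + ε / t) • z + (y - z) = y' + ε • e := by
      have h3 : (ε / t) • z = y' - y + ε • e := by
        rw [hz, smul_smul, div_mul_div_cancel₀ hy.ne', div_self hε.ne', one_smul]
      rw [add_smul, one_smul, h3]
      abel
    simpa only [h1, h2] using h
  have hy' : 0 < y' (Fin.last m) := by rwa [hyy']
  have hcv : ContinuousAt v y' := (S.contDiffAt hy').continuousAt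
  have hct : ContinuousAt (fun ε : ℝ => (1 + ε / t) ^ b * v (y' + ε • e)) 0 := by
    refine ContinuousAt.mul (ContinuousAt.rpow_const (by fun_prop) (Or.inl (by simp))) ?_
    exact ContinuousAt.comp (g := v) (f := fun ε : ℝ => y' + ε • e) (by simpa using hcv)
      (by fun_prop)
  have hlim : Tendsto (fun ε : ℝ => (1 + ε / t) ^ b * v (y' + ε • e)) (𝓝[>] 0) (𝓝 (v y')) := by
    have := hct.tendsto.mono_left (nhdsWithin_le_nhds (s := Ioi 0))
    simpa using this
  refine ge_of_tendsto hlim ?_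
  filter_upwards [self_mem_nhdsWithin] with ε hε using hbound ε hε

lemma eq_of_last_eq (S : IsSubcriticalSol m b v g) (hb : 2 * b = m - 1)
    {y y' : EuclideanSpace ℝ (Fin (m + 1))} (hy : 0 < y (Fin.last m))
    (hyy' : y' (Fin.last m) = y (Fin.last m)) : v y = v y' :=
  le_antisymm (S.le_of_last_eq hb hy hyy') (S.le_of_last_eq hb (by rwa [hyy']) hyy'.symm)

end IsSubcriticalSol

/-- A positive function on `(0, ∞)` whose second derivative is negative, and bounded away from
zero where the function is larger than at `1`, does not exist. -/
lemma not_exists_concave_pos {V V' G : ℝ → ℝ} (hpos : ∀ t, 0 < t → 0 < V t)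
    (hV : ∀ t, 0 < t → HasDerivAt V (V' t) t) (hV' : ∀ t, 0 < t → HasDerivAt V' (-G t) t)
    (hG : ∀ t, 0 < t → 0 < G t) (hmono : ∀ t, 0 < t → V 1 ≤ V t → G 1 ≤ G t) : False := by
  have hanti : AntitoneOn V' (Ioi 0) := by
    refine antitoneOn_of_deriv_nonpos (convex_Ioi 0)
      (fun t ht => (hV' t ht).continuousAt.continuousWithinAt) ?_ ?_
    · rw [interior_Ioi]
      exact fun t ht => (hV' t ht).differentiableAt.differentiableWithinAt
    · rw [interior_Ioi]
      intro t ht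
      rw [(hV' t ht).deriv]
      linarith [hG t ht]
  have hbound : ∀ (f f' : ℝ → ℝ) (a K : ℝ), 0 < a → (∀ t, 0 < t → HasDerivAt f (f' t) t) →
      (∀ t, a < t → f' t ≤ K) → ∀ t, a ≤ t → f t ≤ f a + K * (t - a) := by
    intro f f' a K ha hf hK t hat
    have := Convex.image_sub_le_mul_sub_of_deriv_le (convex_Icc a t)
      (f := f) (C := K) (fun s hs => (hf s (ha.trans_le hs.1)).continuousAt.continuousWithinAt)
      (by
        rw [interior_Icc]
        exact fun s hs => (hf s (ha.trans hs.1)).differentiableAt.differentiableWithinAt)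
      (by
        rw [interior_Icc]
        intro s hs
        rw [(hf s (ha.trans hs.1)).deriv]
        exact hK s hs.1) a (left_mem_Icc.2 hat) t (right_mem_Icc.2 hat) hat
    linarith
  have hnn : ∀ t, 0 < t → 0 ≤ V' t := by
    intro a ha
    by_contra! hneg
    have h1 := hbound V V' a (V' a) ha hV fun t ht => hanti ha (ha.trans ht) ht.le
    have h2 := h1 (a + V a / -V' a) (by
      have := div_pos (hpos a ha) (neg_pos.2 hneg)
      linarith)
    have h3 := hpos (a + V a / -V' a) (by
      have := div_pos (hpos a ha) (neg_pos.2 hneg)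
      linarith)
    have h4 : V' a * (a + V a / -V' a - a) = -V a := by
      field_simp [hneg.ne]
      ring
    linarith
  have hVmono : MonotoneOn V (Ioi 0) := by
    refine monotoneOn_of_deriv_nonneg (convex_Ioi 0)
      (fun t ht => (hV t ht).continuousAt.continuousWithinAt) ?_ ?_
    · rw [interior_Ioi]
      exact fun t ht => (hV t ht).differentiableAt.differentiableWithinAt
    · rw [interior_Ioi]
      intro t ht
      rw [(hV t ht).deriv]
      exact hnn t ht
  have h1 := hbound V' (fun t => -G t) 1 (-G 1) one_pos hV' fun t ht => by
    have ht0 : 0 < t := one_pos.trans ht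
    exact neg_le_neg (hmono t ht0 (hVmono (mem_Ioi.2 one_pos) ht0 ht.le))
  have hG1 := hG 1 one_pos
  have h0 := div_nonneg (hnn 1 one_pos) hG1.le
  have h2 := h1 (1 + (V' 1 / G 1 + 1)) (by linarith)
  have h3 := hnn (1 + (V' 1 / G 1 + 1)) (by linarith)
  have h4 : -G 1 * (1 + (V' 1 / G 1 + 1) - 1) = -V' 1 - G 1 := by
    field_simp
    ring
  linarith

lemma IsSubcriticalSol.elim {m : ℕ} {b : ℝ} {v g : EuclideanSpace ℝ (Fin (m + 1)) → ℝ}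
    (S : IsSubcriticalSol m b v g) (hb : 2 * b = m - 1) : False := by
  set e : EuclideanSpace ℝ (Fin (m + 1)) := stdVec (Fin.last m) with he
  have hel : ∀ t : ℝ, (t • e) (Fin.last m) = t := by
    intro t
    simp [he, stdVec]
  have hpt : ∀ t : ℝ, 0 < t → 0 < (t • e) (Fin.last m) := fun t ht => by rwa [hel]
  have hline : ∀ (t : ℝ) (i : Fin (m + 1)), 0 < t →
      HasDeriv2 (fun s : ℝ => v (t • e + s • stdVec i)) _ _ := fun t i ht =>
    (HasDeriv2.line (t • e) (stdVec i)).comp (by simpa using S.contDiffAt (hpt t ht))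
  have hhess : ∀ t : ℝ, 0 < t → fderiv ℝ (fderiv ℝ v) (t • e) e e = -g (t • e) := by
    intro t ht
    rw [← S.eq _ (hpt t ht), traceHess, Finset.sum_eq_single (Fin.last m)]
    · intro i _ hi
      have h1 : (fun s : ℝ => v (t • e + s • stdVec i)) = fun _ => v (t • e) := by
        ext s
        refine (S.eq_of_last_eq hb (hpt t ht) ?_).symm
        simp [stdVec, hi.symm]
      have h2 := (hline t i ht).unique (h1 ▸ HasDeriv2.const (v (t • e)))
      simpa using h2
    · simp
  have hd : ∀ t : ℝ, HasDerivAt (fun t : ℝ => t • e) e t := fun t => by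
    simpa using (hasDerivAt_id t).smul_const e
  refine not_exists_concave_pos (V := fun t => v (t • e)) (V' := fun t => fderiv ℝ v (t • e) e)
    (G := fun t => g (t • e)) (fun t ht => S.pos _ (hpt t ht)) (fun t ht => ?_) (fun t ht => ?_)
    (fun t ht => S.source_pos _ (hpt t ht))
    (fun t ht h => S.mono _ _ (hpt t ht) (hpt 1 one_pos) h)
  · have h1 : DifferentiableAt ℝ v (t • e) :=
      (S.contDiffAt (hpt t ht)).differentiableAt (by norm_num)
    exact HasFDerivAt.comp_hasDerivAt (f := fun t : ℝ => t • e) t h1.hasFDerivAt (hd t)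
  · rw [← hhess t ht]
    have h1 : DifferentiableAt ℝ (fderiv ℝ v) (t • e) :=
      ((S.contDiffAt (hpt t ht)).fderiv_right (m := 1) (by norm_num)).differentiableAt (by norm_num)
    have h2 : HasDerivAt (fun t : ℝ => fderiv ℝ v (t • e)) (fderiv ℝ (fderiv ℝ v) (t • e) e) t :=
      HasFDerivAt.comp_hasDerivAt (f := fun t : ℝ => t • e) t h1.hasFDerivAt (hd t)
    exact (h2.clm_apply (hasDerivAt_const t e)).congr_deriv (by simp)

section Transform

variable {h : ℝ → ℝ} {α σ p : ℝ}

lemma psi'_pos (h : ℝ → ℝ) (α s : ℝ) : 0 < psi' h α s := Real.exp_pos _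

lemma hasDerivAt_psi' (hα : 0 < α) (hc : ContinuousOn h (Ioi 0)) {s : ℝ} (hs : 0 < s) :
    HasDerivAt (psi' h α) (-h s * psi' h α s) s := by
  have hI : IntervalIntegrable h volume α s :=
    (hc.mono fun t ht => (lt_min hα hs).trans_le ht.1).intervalIntegrable
  have h1 : HasDerivAt (fun s => ∫ r in α..s, h r) (h s) s :=
    intervalIntegral.integral_hasDerivAt_right hI
      (hc.stronglyMeasurableAtFilter isOpen_Ioi s hs) (hc.continuousAt (Ioi_mem_nhds hs))
  exact h1.neg.exp.congr_deriv (mul_comm _ _)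

lemma continuousOn_psi' (hα : 0 < α) (hc : ContinuousOn h (Ioi 0)) :
    ContinuousOn (psi' h α) (Ioi 0) := fun _ hs =>
  (hasDerivAt_psi' hα hc hs).continuousAt.continuousWithinAt

lemma monotoneOn_Ioi_of_hasDerivAt {f f' : ℝ → ℝ} {a : ℝ} (hf : ∀ t, a < t → HasDerivAt f (f' t) t)
    (hf' : ∀ t, a < t → 0 ≤ f' t) : MonotoneOn f (Ioi a) := by
  refine monotoneOn_of_deriv_nonneg (convex_Ioi a)
    (fun t ht => (hf t ht).continuousAt.continuousWithinAt) ?_ ?_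
  · rw [interior_Ioi]
    exact fun t ht => (hf t ht).differentiableAt.differentiableWithinAt
  · rw [interior_Ioi]
    intro t ht
    rw [(hf t ht).deriv]
    exact hf' t ht

lemma intervalIntegrable_psi' (hα : 0 < α) (hc : ContinuousOn h (Ioi 0)) (hσ : σ < 1)
    (hbd : ∀ s, 0 < s → s * h s ≤ σ) {s : ℝ} (hs : 0 < s) :
    IntervalIntegrable (psi' h α) volume 0 s := by
  have hmono : MonotoneOn (fun t => t ^ σ * psi' h α t) (Ioi 0) := by
    refine monotoneOn_Ioi_of_hasDerivAt (fun t ht =>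
      (Real.hasDerivAt_rpow_const (Or.inl ht.ne')).mul (hasDerivAt_psi' hα hc ht))
      fun t ht => ?_
    have h1 : t ^ σ = t ^ (σ - 1) * t := by
      rw [← Real.rpow_add_one ht.ne', sub_add_cancel]
    have h2 : σ * t ^ (σ - 1) * psi' h α t + t ^ σ * (-h t * psi' h α t) =
        t ^ (σ - 1) * psi' h α t * (σ - t * h t) := by
      rw [h1]
      ring
    rw [h2]
    exact mul_nonneg (mul_nonneg (Real.rpow_nonneg ht.le _) (psi'_pos h α t).le)
      (by linarith [hbd t ht])
  have hint : IntervalIntegrable (fun t : ℝ => s ^ σ * psi' h α s * t ^ (-σ)) volume 0 s :=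
    (intervalIntegral.intervalIntegrable_rpow' (by linarith)).const_mul _
  refine hint.mono_fun ?_ ?_
  · rw [uIoc_of_le hs.le]
    exact ((continuousOn_psi' hα hc).mono fun t ht => ht.1).aestronglyMeasurable measurableSet_Ioc
  · rw [uIoc_of_le hs.le]
    filter_upwards [ae_restrict_mem measurableSet_Ioc] with t ht
    have h1 : t ^ σ * psi' h α t ≤ s ^ σ * psi' h α s := hmono ht.1 hs ht.2
    have h2 := mul_le_mul_of_nonneg_right h1 (Real.rpow_nonneg ht.1.le (-σ))
    have h3 : t ^ σ * t ^ (-σ) = 1 := by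
      rw [← Real.rpow_add ht.1, add_neg_cancel, Real.rpow_zero]
    rw [Real.norm_of_nonneg (psi'_pos h α t).le]
    refine le_trans ?_ (le_abs_self _)
    calc psi' h α t = t ^ σ * psi' h α t * t ^ (-σ) := by
          rw [mul_right_comm, h3, one_mul]
      _ ≤ _ := h2

lemma hasDerivAt_psi (hα : 0 < α) (hc : ContinuousOn h (Ioi 0)) (hσ : σ < 1)
    (hbd : ∀ s, 0 < s → s * h s ≤ σ) {s : ℝ} (hs : 0 < s) :
    HasDerivAt (psi h α) (psi' h α s) s :=
  intervalIntegral.integral_hasDerivAt_right (intervalIntegrable_psi' hα hc hσ hbd hs)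
    ((continuousOn_psi' hα hc).stronglyMeasurableAtFilter isOpen_Ioi s hs)
    ((continuousOn_psi' hα hc).continuousAt (Ioi_mem_nhds hs))

lemma psi_zero (h : ℝ → ℝ) (α : ℝ) : psi h α 0 = 0 := intervalIntegral.integral_same

lemma continuousOn_psi (hα : 0 < α) (hc : ContinuousOn h (Ioi 0)) (hσ : σ < 1)
    (hbd : ∀ s, 0 < s → s * h s ≤ σ) : ContinuousOn (psi h α) (Ici 0) := by
  intro s hs
  rcases (mem_Ici.1 hs).eq_or_lt with rfl | hs
  · have h1 : ContinuousOn (psi h α) (uIcc 0 1) :=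
      intervalIntegral.continuousOn_primitive_interval'
        (intervalIntegrable_psi' hα hc hσ hbd one_pos) (by simp)
    rw [uIcc_of_le zero_le_one] at h1
    exact (h1 0 (by simp)).mono_of_mem_nhdsWithin (Icc_mem_nhdsGE one_pos)
  · exact (hasDerivAt_psi hα hc hσ hbd hs).continuousAt.continuousWithinAt

lemma strictMonoOn_psi (hα : 0 < α) (hc : ContinuousOn h (Ioi 0)) (hσ : σ < 1)
    (hbd : ∀ s, 0 < s → s * h s ≤ σ) : StrictMonoOn (psi h α) (Ici 0) := by
  refine strictMonoOn_of_deriv_pos (convex_Ici 0) (continuousOn_psi hα hc hσ hbd) fun s hs => ?_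
  rw [interior_Ici] at hs
  rw [(hasDerivAt_psi hα hc hσ hbd hs).deriv]
  exact psi'_pos h α s

lemma psi_pos (hα : 0 < α) (hc : ContinuousOn h (Ioi 0)) (hσ : σ < 1)
    (hbd : ∀ s, 0 < s → s * h s ≤ σ) {s : ℝ} (hs : 0 < s) : 0 < psi h α s := by
  have := strictMonoOn_psi hα hc hσ hbd (mem_Ici.2 le_rfl) (mem_Ici.2 hs.le) hs
  rwa [psi_zero] at this

lemma exists_lt_psi (hα : 0 < α) (hc : ContinuousOn h (Ioi 0)) (hσ : σ < 1)
    (hbd : ∀ s, 0 < s → s * h s ≤ σ) (M : ℝ) : ∃ s, 0 < s ∧ M < psi h α s := by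
  set c := psi' h α 1 with hcdef
  have hc0 : 0 < c := psi'_pos h α 1
  have hmono : MonotoneOn (fun t => t * psi' h α t) (Ioi 0) := by
    refine monotoneOn_Ioi_of_hasDerivAt
      (fun t ht => (hasDerivAt_id t).mul (hasDerivAt_psi' hα hc ht)) fun t ht => ?_
    have h2 : 1 * psi' h α t + id t * (-h t * psi' h α t) = psi' h α t * (1 - t * h t) := by
      simp only [id]
      ring
    rw [h2]
    exact mul_nonneg (psi'_pos h α t).le (by linarith [hbd t ht])
  have hlow : ∀ t, 1 ≤ t → c / t ≤ psi' h α t := by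
    intro t ht
    have ht0 : 0 < t := one_pos.trans_le ht
    rw [div_le_iff₀ ht0, mul_comm]
    simpa using hmono (mem_Ioi.2 one_pos) ht0 ht
  have hd : ∀ t, 0 < t →
      HasDerivAt (fun t => psi h α t - c * Real.log t) (psi' h α t - c / t) t := fun t ht =>
    (hasDerivAt_psi hα hc hσ hbd ht).sub ((Real.hasDerivAt_log ht.ne').const_mul c)
  have hmono2 : MonotoneOn (fun t => psi h α t - c * Real.log t) (Ici 1) := by
    refine monotoneOn_of_deriv_nonneg (convex_Ici 1)
      (fun t ht => (hd t (one_pos.trans_le ht)).continuousAt.continuousWithinAt) ?_ ?_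
    · rw [interior_Ici]
      exact fun t ht => (hd t (one_pos.trans ht)).differentiableAt.differentiableWithinAt
    · rw [interior_Ici]
      intro t ht
      rw [(hd t (one_pos.trans ht)).deriv]
      linarith [hlow t (mem_Ioi.1 ht).le]
  have hM : 0 ≤ max M 0 / c := div_nonneg (le_max_right _ _) hc0.le
  refine ⟨Real.exp (max M 0 / c), Real.exp_pos _, ?_⟩
  have h1 := hmono2 (mem_Ici.2 le_rfl) (mem_Ici.2 (Real.one_le_exp hM)) (Real.one_le_exp hM)
  simp only [Real.log_one, mul_zero, sub_zero, Real.log_exp, mul_div_cancel₀ _ hc0.ne'] at h1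
  linarith [psi_pos hα hc hσ hbd one_pos, le_max_left M 0]

lemma contDiffOn_psi (hα : 0 < α) (hc : ContinuousOn h (Ioi 0)) (hσ : σ < 1)
    (hbd : ∀ s, 0 < s → s * h s ≤ σ) : ContDiffOn ℝ 2 (psi h α) (Ioi 0) := by
  rw [show (2 : WithTop ℕ∞) = 1 + 1 by norm_num, contDiffOn_succ_iff_deriv_of_isOpen isOpen_Ioi]
  refine ⟨fun s hs => (hasDerivAt_psi hα hc hσ hbd hs).differentiableAt.differentiableWithinAt,
    by simp, ?_⟩
  have h1 : ContDiffOn ℝ 1 (psi' h α) (Ioi 0) := by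
    rw [show (1 : WithTop ℕ∞) = 0 + 1 by norm_num, contDiffOn_succ_iff_deriv_of_isOpen isOpen_Ioi]
    refine ⟨fun s hs => (hasDerivAt_psi' hα hc hs).differentiableAt.differentiableWithinAt,
      by simp, ?_⟩
    rw [contDiffOn_zero]
    exact (hc.neg.mul (continuousOn_psi' hα hc)).congr fun s hs => (hasDerivAt_psi' hα hc hs).deriv
  exact h1.congr fun s hs => (hasDerivAt_psi hα hc hσ hbd hs).deriv

lemma hasDerivAt_psi'_mul_rpow (hα : 0 < α) (hc : ContinuousOn h (Ioi 0)) {s : ℝ} (hs : 0 < s) :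
    HasDerivAt (fun s => psi' h α s * s ^ p) (psi' h α s * (s ^ (p - 1) * (p - s * h s))) s := by
  refine ((hasDerivAt_psi' hα hc hs).mul
    (Real.hasDerivAt_rpow_const (p := p) (Or.inl hs.ne'))).congr_deriv ?_
  have h1 : s ^ p = s ^ (p - 1) * s := by
    rw [← Real.rpow_add_one hs.ne', sub_add_cancel]
  rw [h1]
  ring

lemma monotoneOn_psi'_mul_rpow (hα : 0 < α) (hc : ContinuousOn h (Ioi 0)) (hσ : σ < 1)
    (hbd : ∀ s, 0 < s → s * h s ≤ σ) (hp : 1 < p) :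
    MonotoneOn (fun s => psi' h α s * s ^ p) (Ioi 0) :=
  monotoneOn_Ioi_of_hasDerivAt (fun _ ht => hasDerivAt_psi'_mul_rpow hα hc ht) fun t ht =>
    mul_nonneg (psi'_pos h α t).le
      (mul_nonneg (Real.rpow_nonneg ht.le _) (by linarith [hbd t ht]))

lemma psi'_mul_rpow_sub_le (hα : 0 < α) (hc : ContinuousOn h (Ioi 0)) (hσ : σ < 1)
    (hnn : ∀ s, 0 < s → 0 ≤ h s) (hbd : ∀ s, 0 < s → s * h s ≤ σ) (hp : 1 < p) {s t K : ℝ}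
    (hs : 0 < s) (hst : s ≤ t) (htK : t ≤ K) :
    psi' h α t * t ^ p - psi' h α s * s ^ p ≤ p * K ^ (p - 1) * (psi h α t - psi h α s) := by
  have hd : ∀ r, 0 < r → HasDerivAt (fun r => p * K ^ (p - 1) * psi h α r - psi' h α r * r ^ p)
      (p * K ^ (p - 1) * psi' h α r - psi' h α r * (r ^ (p - 1) * (p - r * h r))) r := fun r hr =>
    ((hasDerivAt_psi hα hc hσ hbd hr).const_mul _).sub (hasDerivAt_psi'_mul_rpow hα hc hr)
  have hmono : MonotoneOn (fun r => p * K ^ (p - 1) * psi h α r - psi' h α r * r ^ p)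
      (Icc s t) := by
    refine monotoneOn_of_deriv_nonneg (convex_Icc s t)
      (fun r hr => (hd r (hs.trans_le hr.1)).continuousAt.continuousWithinAt) ?_ ?_
    · rw [interior_Icc]
      exact fun r hr => (hd r (hs.trans hr.1)).differentiableAt.differentiableWithinAt
    · rw [interior_Icc]
      intro r hr
      have hr0 : 0 < r := hs.trans hr.1
      rw [(hd r hr0).deriv]
      have h1 : r ^ (p - 1) ≤ K ^ (p - 1) :=
        Real.rpow_le_rpow hr0.le (hr.2.le.trans htK) (by linarith)
      have h2 : r ^ (p - 1) * (p - r * h r) ≤ K ^ (p - 1) * p := by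
        have h3 := mul_nonneg hr0.le (hnn r hr0)
        have h4 := Real.rpow_nonneg hr0.le (p - 1)
        nlinarith
      nlinarith [psi'_pos h α r]
  have := hmono (left_mem_Icc.2 hst) (right_mem_Icc.2 hst) hst
  simp only at this
  linarith

lemma psi'_mul_rpow_lt (hα : 0 < α) (hc : ContinuousOn h (Ioi 0)) (hσ : σ < 1)
    (hbd : ∀ s, 0 < s → s * h s ≤ σ) {q b : ℝ} (hq : b * q = b + 2) (hb : 0 < b)
    (hdec : StrictAntiOn (fun s => psi' h α s * s ^ p / psi h α s ^ q) (Ioi 0)) {s t c : ℝ}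
    (hs : 0 < s) (ht : 0 < t) (h1c : 1 < c) (heq : c ^ b * psi h α s = psi h α t) :
    psi' h α t * t ^ p < c ^ (b + 2) * (psi' h α s * s ^ p) := by
  have hψs := psi_pos hα hc hσ hbd hs
  have hψt := psi_pos hα hc hσ hbd ht
  have hst : s < t := by
    rw [← (strictMonoOn_psi hα hc hσ hbd).lt_iff_lt (mem_Ici.2 hs.le) (mem_Ici.2 ht.le), ← heq]
    exact lt_mul_of_one_lt_left hψs (Real.one_lt_rpow h1c hb)
  have h1 : psi' h α t * t ^ p / psi h α t ^ q < psi' h α s * s ^ p / psi h α s ^ q :=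
    hdec hs ht hst
  have hc0 : 0 < c := by linarith
  rw [← heq, Real.mul_rpow (Real.rpow_nonneg hc0.le _) hψs.le, ← Real.rpow_mul hc0.le, hq] at h1
  have h2 := Real.rpow_pos_of_pos hψs q
  have h3 := Real.rpow_pos_of_pos hc0 (b + 2)
  rw [div_lt_div_iff₀ (mul_pos h3 h2) h2] at h1
  refine lt_of_mul_lt_mul_right ?_ h2.le
  linarith

end Transform

lemma lap_eq_traceHess {n : ℕ} {u : EuclideanSpace ℝ (Fin n) → ℝ} {x : EuclideanSpace ℝ (Fin n)}
    (hu : ContDiffAt ℝ 2 u x) : lap u x = traceHess u x := by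
  have h1 : DifferentiableAt ℝ (fderiv ℝ u) x :=
    (hu.fderiv_right (m := 1) (by norm_num)).differentiableAt (by norm_num)
  refine Finset.sum_congr rfl fun i _ => ?_
  rw [fderiv_clm_apply h1 (differentiableAt_const _)]
  simp

lemma norm_gradient_sq {n : ℕ} {u : EuclideanSpace ℝ (Fin n) → ℝ}
    (x : EuclideanSpace ℝ (Fin n)) :
    ‖gradient u x‖ ^ 2 = ∑ i, (fderiv ℝ u x (stdVec i)) ^ 2 := by
  rw [← sum_sq_eq_norm_sq]
  refine Finset.sum_congr rfl fun i _ => ?_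
  have h1 : inner ℝ (gradient u x) (stdVec i) = fderiv ℝ u x (stdVec i) := by
    rw [gradient, InnerProductSpace.toDual_symm_apply]
  rw [EuclideanSpace.inner_single_right] at h1
  simpa using congrArg (· ^ 2) h1

lemma traceHess_comp {n : ℕ} {u : EuclideanSpace ℝ (Fin n) → ℝ} {x : EuclideanSpace ℝ (Fin n)}
    (hu : ContDiffAt ℝ 2 u x) {φ φ' : ℝ → ℝ} {φ'' : ℝ} (hφ : ContDiffAt ℝ 2 φ (u x))
    (h1 : ∀ᶠ t in 𝓝 (u x), HasDerivAt φ (φ' t) t) (h2 : HasDerivAt φ' φ'' (u x)) :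
    traceHess (fun y => φ (u y)) x =
      φ'' * ‖gradient u x‖ ^ 2 + φ' (u x) * lap u x := by
  have hv : ContDiffAt ℝ 2 (fun y => φ (u y)) x := hφ.comp x hu
  rw [norm_gradient_sq, lap_eq_traceHess hu, traceHess, traceHess, Finset.mul_sum, Finset.mul_sum,
    ← Finset.sum_add_distrib]
  refine Finset.sum_congr rfl fun i _ => ?_
  have hL : HasDeriv2 (fun s : ℝ => u (x + s • stdVec i)) _ _ :=
    (HasDeriv2.line x (stdVec i)).comp (by simpa using hu)
  have hR : HasDeriv2 (fun s : ℝ => φ (u (x + s • stdVec i))) _ _ :=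
    (HasDeriv2.line x (stdVec i)).comp (v := fun y => φ (u y)) (by simpa using hv)
  have hL' := hL.comp_real (φ := φ) (φ' := φ') (φ'' := φ'') (by simpa using h1) (by simpa using h2)
  have := hR.unique hL'
  simpa using this

theorem liouville_half_space
    {m : ℕ} (hN : 3 ≤ m + 1) {p σ α : ℝ} (hp : 1 < p) (hσ : σ ∈ Set.Ioo (0:ℝ) 1) (hα : 0 < α)
    (h : ℝ → ℝ) (hh_cont : ContinuousOn h (Set.Ioi 0))
    (hh_nonneg : ∀ s : ℝ, 0 < s → 0 ≤ h s) (hh_bd : ∀ s : ℝ, 0 < s → s * h s ≤ σ)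
    (hdec : StrictAntiOn (fun s => psi' h α s * s ^ p / psi h α s ^ (twoStar (m + 1) - 1))
      (Set.Ioi 0)) :
    ¬ ∃ u : EuclideanSpace ℝ (Fin (m + 1)) → ℝ,
      ContinuousOn u {x | 0 ≤ x (Fin.last m)} ∧
      (∀ x : EuclideanSpace ℝ (Fin (m + 1)), x (Fin.last m) = 0 → u x = 0) ∧
      ContDiffOn ℝ 2 u {x | 0 < x (Fin.last m)} ∧
      (∀ x : EuclideanSpace ℝ (Fin (m + 1)), 0 < x (Fin.last m) → 0 < u x) ∧
      (∀ x : EuclideanSpace ℝ (Fin (m + 1)), 0 < x (Fin.last m) →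
        -lap u x + h (u x) * ‖gradient u x‖ ^ 2 = u x ^ p) := by
  rintro ⟨u, hu_cont, hu_zero, hu_smooth, hu_pos, hu_eq⟩
  have hσ1 := hσ.2
  have hm : (2 : ℝ) ≤ m := by exact_mod_cast (by omega : 2 ≤ m)
  set b : ℝ := (m - 1) / 2 with hb
  have hb0 : 0 < b := by rw [hb]; linarith
  have hq : b * (twoStar (m + 1) - 1) = b + 2 := by
    have : (m : ℝ) - 1 ≠ 0 := by linarith
    rw [hb, twoStar]
    push_cast
    rw [show (m : ℝ) + 1 - 2 = m - 1 by ring]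
    field_simp
    ring
  have hψ := strictMonoOn_psi hα hh_cont hσ1 hh_bd
  have hF := monotoneOn_psi'_mul_rpow hα hh_cont hσ1 hh_bd hp
  have hψc := continuousOn_psi hα hh_cont hσ1 hh_bd
  have hu_nonneg : ∀ x : EuclideanSpace ℝ (Fin (m + 1)), 0 ≤ x (Fin.last m) → 0 ≤ u x := by
    intro x hx
    rcases hx.eq_or_lt with h0 | h0
    · exact (hu_zero x h0.symm).ge
    · exact (hu_pos x h0).le
  refine IsSubcriticalSol.elim (m := m) (b := b) (v := fun x => psi h α (u x))
    (g := fun x => psi' h α (u x) * u x ^ p) ⟨?_, ?_, ?_, ?_, ?_, ?_, ?_, ?_, ?_⟩ (by rw [hb]; ring)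
  · exact hψc.comp hu_cont fun x hx => hu_nonneg x hx
  · intro x hx
    simp only [hu_zero x hx, psi_zero]
  · exact (contDiffOn_psi hα hh_cont hσ1 hh_bd).comp hu_smooth fun x hx => hu_pos x hx
  · exact fun x hx => psi_pos hα hh_cont hσ1 hh_bd (hu_pos x hx)
  · intro x hx
    have hux := hu_pos x hx
    rw [traceHess_comp (φ := psi h α)
      (hu_smooth.contDiffAt ((isOpen_lt continuous_const (continuous_last m)).mem_nhds hx))
      ((contDiffOn_psi hα hh_cont hσ1 hh_bd).contDiffAt (Ioi_mem_nhds hux))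
      (by
        filter_upwards [Ioi_mem_nhds hux] with t ht using hasDerivAt_psi hα hh_cont hσ1 hh_bd ht)
      (hasDerivAt_psi' hα hh_cont hux), ← hu_eq x hx]
    ring
  · intro M
    obtain ⟨K, hK0, hK⟩ := exists_lt_psi hα hh_cont hσ1 hh_bd M
    refine ⟨p * K ^ (p - 1), by have := Real.rpow_nonneg hK0.le (p - 1); positivity, ?_⟩
    intro x y hx hy hxM c h1c hle
    have hux := hu_pos x hx
    have huy := hu_pos y hy
    have hψy := psi_pos hα hh_cont hσ1 hh_bd huy
    have hcb : 1 ≤ c ^ b := Real.one_le_rpow h1c hb0.le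
    have hψle : psi h α (u y) ≤ c ^ b * psi h α (u y) := le_mul_of_one_le_left hψy.le hcb
    have hyx : u y ≤ u x :=
      (hψ.le_iff_le (mem_Ici.2 huy.le) (mem_Ici.2 hux.le)).1 (hψle.trans hle)
    have hxK : u x ≤ K :=
      ((hψ.lt_iff_lt (mem_Ici.2 hux.le) (mem_Ici.2 hK0.le)).1 (hxM.trans_lt hK)).le
    obtain ⟨s, ⟨hys, hsx⟩, hs⟩ := intermediate_value_Icc hyx
      (hψc.mono fun t ht => huy.le.trans ht.1) ⟨hψle, hle⟩
    have hs0 : 0 < s := huy.trans_le hys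
    have h1 := psi'_mul_rpow_sub_le hα hh_cont hσ1 hh_nonneg hh_bd hp hs0 hsx hxK
    have h2 : psi' h α s * s ^ p ≤ c ^ (b + 2) * (psi' h α (u y) * u y ^ p) := by
      rcases h1c.eq_or_lt with rfl | h1c
      · rw [Real.one_rpow, one_mul] at hs
        rw [hψ.injOn (mem_Ici.2 hs0.le) (mem_Ici.2 huy.le) hs, Real.one_rpow, one_mul]
      · exact (psi'_mul_rpow_lt hα hh_cont hσ1 hh_bd hq hb0 hdec huy hs0 h1c hs.symm).le
    rw [hs] at h1
    linarith
  · exact fun x y hx hy c h1c heq => psi'_mul_rpow_lt hα hh_cont hσ1 hh_bd hq hb0 hdec (hu_pos y hy)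
      (hu_pos x hx) h1c heq
  · intro x y hx hy hle
    exact hF (hu_pos y hy) (hu_pos x hx)
      ((hψ.le_iff_le (mem_Ici.2 (hu_pos y hy).le) (mem_Ici.2 (hu_pos x hx).le)).1 hle)
  · exact fun x hx => mul_pos (psi'_pos h α _) (Real.rpow_pos_of_pos (hu_pos x hx) p)
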